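/- Let 0 < α < 1 and λ > 0 (standard metric case ψ(t) = t). Then the memory kernel 𝒦(t) := t^{α−1} E_{α,α}(−λ t^α) exhibits heavy-tailed power-law decay: lim_{t → ∞} t^{1+α} · 𝒦(t) = −1/(λ² Γ(−α)), and in particular 𝒦(t) = O(t^{−(1+α)}) as t → ∞. -/

import Mathlib

open MeasureTheory Set Filter

noncomputable section

/-- The two-parameter Mittag-Leffler function (real argument). -/
def mlE (α β x : ℝ) : ℝ := ∑' k : ℕ, x ^ k / Real.Gamma (α * k + β)

open scoped ENNReal Topology

theorem Complex.exp_ne_one_of_abs_im_le_pi {w : ℂ} (hw : w ≠ 0) (him : |w.im| ≤ Real.pi) :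
    Complex.exp w ≠ 1 := by
  intro h
  obtain ⟨n, hn⟩ := Complex.exp_eq_one_iff.1 h
  have him' : w.im = n * (2 * Real.pi) := by
    rw [hn]; simp
  have hn0 : n = 0 := by
    rw [him', abs_mul, abs_of_pos Real.two_pi_pos] at him
    have : |(n : ℝ)| < 1 := by nlinarith [Real.pi_pos, abs_nonneg (n : ℝ)]
    exact Int.abs_lt_one_iff.1 (by exact_mod_cast this)
  exact hw (by simpa [hn0] using hn)

theorem Complex.mul_exp_add_one_ne_zero {c : ℝ} (hc : 0 < c) {z : ℂ} (him : |z.im| < Real.pi) :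
    (c : ℂ) * Complex.exp z + 1 ≠ 0 := by
  intro h
  have hre := congrArg Complex.re h
  have him0 := congrArg Complex.im h
  have hE := Real.exp_pos z.re
  simp [Complex.exp_re, Complex.exp_im, hc.ne'] at hre him0
  rw [Real.sin_eq_zero_iff_of_lt_of_lt (abs_lt.1 him).1 (abs_lt.1 him).2] at him0
  rw [him0, Real.cos_zero] at hre
  nlinarith [mul_pos hc hE]

theorem exists_differentiableOn_strip {α c : ℝ} (hα : 0 < α) (hα1 : α < 1) (hc : 0 < c) :
    ∃ H : ℂ → ℂ, DifferentiableOn ℂ H {w | |w.im| ≤ Real.pi} ∧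
      ∀ w ≠ 0, |w.im| ≤ Real.pi → H w =
        (1 / (c * Complex.exp (α * w) + 1) - 1 / (c + 1)) *
          (Complex.exp w / (Complex.exp w - 1)) := by
  have hd : ∀ f : ℂ → ℂ, Differentiable ℂ f → Differentiable ℂ (dslope f 0) := fun f hf =>
    differentiableOn_univ.1 ((Complex.differentiableOn_dslope univ_mem).2 hf.differentiableOn)
  have hden : ∀ w : ℂ, |w.im| ≤ Real.pi → (c : ℂ) * Complex.exp (α * w) + 1 ≠ 0 := fun w hw => by
    refine Complex.mul_exp_add_one_ne_zero hc ?_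
    simp only [Complex.mul_im, Complex.ofReal_re, Complex.ofReal_im, zero_mul, add_zero, abs_mul,
      abs_of_pos hα]
    nlinarith [Real.pi_pos]
  have hc1 : (c : ℂ) + 1 ≠ 0 := by exact_mod_cast (by positivity : c + 1 ≠ 0)
  have hslope : ∀ w : ℂ, |w.im| ≤ Real.pi → dslope Complex.exp 0 w ≠ 0 := fun w hw => by
    rcases eq_or_ne w 0 with rfl | h0
    · simp
    · rw [dslope_of_ne _ h0, slope_def_field]
      have := Complex.exp_ne_one_of_abs_im_le_pi h0 hw
      simp [sub_ne_zero, this, h0]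
  refine ⟨fun w => dslope (fun z => Complex.exp (α * z)) 0 w / dslope Complex.exp 0 w *
    (Complex.exp w / (c * Complex.exp (α * w) + 1)) * (-c / (c + 1)), ?_, ?_⟩
  · intro w hw
    have h1 := hd (fun z => Complex.exp (α * z)) (by fun_prop) w
    have h2 := hd Complex.exp (by fun_prop) w
    have h3 : DifferentiableAt ℂ (fun w => Complex.exp w / (c * Complex.exp (α * w) + 1)) w :=
      (by fun_prop : DifferentiableAt ℂ Complex.exp w).div (by fun_prop) (hden w hw)
    exact (((h1.div h2 (hslope w hw)).mul h3).mul_const _).differentiableWithinAt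
  · intro w h0 hw
    have h1 := hden w hw
    have h2 : Complex.exp w - 1 ≠ 0 := sub_ne_zero.2 (Complex.exp_ne_one_of_abs_im_le_pi h0 hw)
    simp only [dslope_of_ne _ h0, slope_def_field, sub_zero, mul_zero, Complex.exp_zero]
    generalize Complex.exp (α * w) = A at h1 ⊢
    generalize Complex.exp w = B at h2 ⊢
    obtain ⟨D, hD⟩ : ∃ D, (c : ℂ) * A + 1 = D := ⟨_, rfl⟩
    rw [hD] at h1 ⊢
    field_simp
    linear_combination -B * hD

theorem tendsto_intervalIntegral_of_norm_sub_le {ι : Type*} {l : Filter ι} {a b : ℝ} (hab : a ≤ b)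
    {F : ι → ℝ → ℂ} {L : ℂ} {B : ι → ℝ} (hF : ∀ i, ContinuousOn (F i) (Icc a b))
    (hB : ∀ᶠ i in l, ∀ y ∈ Icc a b, ‖F i y - L‖ ≤ B i) (hB0 : Tendsto B l (𝓝 0)) :
    Tendsto (fun i => ∫ y in a..b, F i y) l (𝓝 ((b - a) * L)) := by
  rw [tendsto_iff_norm_sub_tendsto_zero]
  refine squeeze_zero' (Eventually.of_forall fun _ => norm_nonneg _) ?_
    (by simpa using hB0.mul_const |b - a|)
  filter_upwards [hB] with i hi
  have : ∫ y in a..b, (F i y - L) = (∫ y in a..b, F i y) - (b - a) * L := by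
    rw [intervalIntegral.integral_sub ((hF i).intervalIntegrable_of_Icc hab) (by simp)]
    simp
  rw [← this]
  refine intervalIntegral.norm_integral_le_of_norm_le_const fun y hy => hi y ?_
  rw [uIoc_of_le hab] at hy
  exact Ioc_subset_Icc_self hy

theorem tendsto_intervalIntegral_stieltjes {α c : ℝ} (hα : 0 < α) (hα1 : α < 1) (hc : 0 < c) :
    Tendsto (fun R : ℝ => ∫ u in -R..R, Real.sin (Real.pi * α) * (c * Real.exp (α * u)) /
        ((c * Real.exp (α * u)) ^ 2 + 2 * (c * Real.exp (α * u)) * Real.cos (Real.pi * α) + 1) *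
        (Real.exp u / (Real.exp u + 1))) atTop (𝓝 (Real.pi / (c + 1))) := by
  obtain ⟨H, hH, hHeq⟩ := exists_differentiableOn_strip hα hα1 hc
  have hpi := Real.pi_pos
  have hcont : ∀ R : ℝ, ContinuousOn (fun y : ℝ => H (R + y * Complex.I))
      (Icc (-Real.pi) Real.pi) := fun R =>
    hH.continuousOn.comp (by fun_prop) fun y hy => by simpa [abs_le] using hy
  have hexpα : Tendsto (fun R : ℝ => c * Real.exp (α * R)) atTop atTop :=
    (Real.tendsto_exp_atTop.comp (tendsto_id.const_mul_atTop hα)).const_mul_atTop hc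
  have hnorm : ∀ R y : ℝ, ‖Complex.exp (R + y * Complex.I)‖ = Real.exp R := fun R y => by
    simp [Complex.norm_exp]
  have hnormα : ∀ R y : ℝ, ‖(c : ℂ) * Complex.exp (α * (R + y * Complex.I))‖ =
      c * Real.exp (α * R) := fun R y => by
    simp [Complex.norm_exp, abs_of_pos hc]
  have hright : Tendsto (fun R : ℝ => ∫ y in -Real.pi..Real.pi, H (R + y * Complex.I)) atTop
      (𝓝 ((Real.pi - (-Real.pi : ℝ)) * (-(1 / (c + 1))))) := by
    refine tendsto_intervalIntegral_of_norm_sub_le (by linarith) hcont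
      (B := fun R => 1 / (c * Real.exp (α * R) - 1) * (1 + 1 / (Real.exp R - 1)) +
        1 / (Real.exp R - 1)) ?_ ?_
    · filter_upwards [eventually_gt_atTop 0, hexpα.eventually_gt_atTop 1] with R hR hR1 y hy
      have him : |((R : ℂ) + y * Complex.I).im| ≤ Real.pi := by simpa [abs_le] using hy
      have hw0 : (R : ℂ) + y * Complex.I ≠ 0 := fun h => hR.ne' (by simpa using congrArg Complex.re h)
      have hE : 1 < Real.exp R := Real.one_lt_exp_iff.2 hR
      rw [hHeq _ hw0 him]
      have hn1 := hnorm R y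
      have hn2 := hnormα R y
      have hne := Complex.exp_ne_one_of_abs_im_le_pi hw0 him
      generalize (c : ℂ) * Complex.exp (α * (R + y * Complex.I)) = A at *
      generalize Complex.exp (R + y * Complex.I) = E at *
      have hA : c * Real.exp (α * R) - 1 ≤ ‖A + 1‖ := by
        have := norm_sub_norm_le A (-1); simpa [hn2] using this
      have hE' : Real.exp R - 1 ≤ ‖E - 1‖ := by
        have := norm_sub_norm_le E 1; simpa [hn1] using this
      have hq : ‖1 / (E - 1)‖ ≤ 1 / (Real.exp R - 1) := by
        rw [norm_div, norm_one]
        exact one_div_le_one_div_of_le (by linarith) hE'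
      have hr : ‖1 / (A + 1)‖ ≤ 1 / (c * Real.exp (α * R) - 1) := by
        rw [norm_div, norm_one]
        exact one_div_le_one_div_of_le (by linarith) hA
      have hcn : ‖1 / ((c : ℂ) + 1)‖ ≤ 1 := by
        have : (c : ℂ) + 1 = ((c + 1 : ℝ) : ℂ) := by push_cast; rfl
        rw [this, norm_div, norm_one, Complex.norm_real, Real.norm_of_nonneg (by positivity)]
        exact (div_le_one (by positivity)).2 (by linarith)
      have hid : (1 / (A + 1) - 1 / (c + 1)) * (E / (E - 1)) - -(1 / ((c : ℂ) + 1)) =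
          1 / (A + 1) * (1 + 1 / (E - 1)) - 1 / (c + 1) * (1 / (E - 1)) := by
        have : E / (E - 1) = 1 + 1 / (E - 1) := by
          field_simp [sub_ne_zero.2 hne]
          ring
        rw [this]; ring
      rw [hid]
      refine (norm_sub_le _ _).trans (add_le_add ?_ ?_)
      · rw [norm_mul]
        refine mul_le_mul hr ((norm_add_le _ _).trans ?_) (norm_nonneg _) ?_
        · rw [norm_one]; linarith
        · exact (norm_nonneg _).trans hr
      · rw [norm_mul]
        nlinarith [norm_nonneg (1 / (E - 1)), norm_nonneg (1 / ((c : ℂ) + 1))]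
    · have h1 : Tendsto (fun R => 1 / (Real.exp R - 1)) atTop (𝓝 0) :=
        (tendsto_atTop_add_const_right _ (-1) Real.tendsto_exp_atTop).const_div_atTop 1
      have h2 : Tendsto (fun R => 1 / (c * Real.exp (α * R) - 1)) atTop (𝓝 0) :=
        (tendsto_atTop_add_const_right _ (-1) hexpα).const_div_atTop 1
      simpa using (h2.mul (h1.const_add 1)).add h1
  have hleft : Tendsto (fun R : ℝ => ∫ y in -Real.pi..Real.pi, H ((-R : ℝ) + y * Complex.I)) atTop
      (𝓝 ((Real.pi - (-Real.pi : ℝ)) * 0)) := by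
    have hexp0 : Tendsto (fun R : ℝ => Real.exp (-R)) atTop (𝓝 0) :=
      Real.tendsto_exp_neg_atTop_nhds_zero
    have hexpα0 : Tendsto (fun R : ℝ => c * Real.exp (α * -R)) atTop (𝓝 0) := by
      have : Tendsto (fun R : ℝ => Real.exp (-(α * R))) atTop (𝓝 0) :=
        hexp0.comp (tendsto_id.const_mul_atTop hα)
      simpa using this.const_mul c
    refine tendsto_intervalIntegral_of_norm_sub_le (by linarith) (fun R => hcont (-R))
      (B := fun R => (1 / (1 - c * Real.exp (α * -R)) + 1) *
        (Real.exp (-R) / (1 - Real.exp (-R)))) ?_ ?_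
    · filter_upwards [eventually_gt_atTop 0, hexpα0.eventually_lt_const one_pos] with R hR hR1 y hy
      have him : |(((-R : ℝ) : ℂ) + y * Complex.I).im| ≤ Real.pi := by simpa [abs_le] using hy
      have hw0 : ((-R : ℝ) : ℂ) + y * Complex.I ≠ 0 :=
        fun h => hR.ne' (by simpa using congrArg Complex.re h)
      have hE : Real.exp (-R) < 1 := Real.exp_lt_one_iff.2 (by linarith)
      rw [hHeq _ hw0 him]
      have hn1 := hnorm (-R) y
      have hn2 := hnormα (-R) y
      generalize (c : ℂ) * Complex.exp (α * ((-R : ℝ) + y * Complex.I)) = A at *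
      generalize Complex.exp ((-R : ℝ) + y * Complex.I) = E at *
      have hA : 1 - c * Real.exp (α * -R) ≤ ‖A + 1‖ := by
        have := norm_sub_norm_le 1 (-A); simpa [hn2, add_comm] using this
      have hE' : 1 - Real.exp (-R) ≤ ‖E - 1‖ := by
        have := norm_sub_norm_le 1 E; rw [norm_sub_rev, norm_one, hn1] at this; exact this
      have hr : ‖1 / (A + 1)‖ ≤ 1 / (1 - c * Real.exp (α * -R)) := by
        rw [norm_div, norm_one]
        exact one_div_le_one_div_of_le (by linarith) hA
      have hcn : ‖1 / ((c : ℂ) + 1)‖ ≤ 1 := by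
        have : (c : ℂ) + 1 = ((c + 1 : ℝ) : ℂ) := by push_cast; rfl
        rw [this, norm_div, norm_one, Complex.norm_real, Real.norm_of_nonneg (by positivity)]
        exact (div_le_one (by positivity)).2 (by linarith)
      rw [sub_zero, norm_mul]
      refine mul_le_mul ((norm_sub_le _ _).trans (add_le_add hr hcn)) ?_ (norm_nonneg _) ?_
      · rw [norm_div, hn1]
        exact div_le_div_of_nonneg_left (Real.exp_nonneg _) (by linarith) hE'
      · exact add_nonneg ((norm_nonneg _).trans hr) zero_le_one
    · have h1 : Tendsto (fun R => Real.exp (-R) / (1 - Real.exp (-R))) atTop (𝓝 0) := by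
        have := hexp0.div (hexp0.const_sub 1) (by simp)
        rwa [zero_div] at this
      have h2 : Tendsto (fun R => 1 / (1 - c * Real.exp (α * -R)) + 1) atTop (𝓝 (1 / (1 - 0) + 1)) :=
        ((tendsto_const_nhds (x := (1 : ℝ))).div (hexpα0.const_sub 1) (by simp)).add_const 1
      simpa using h2.mul h1
  have hrect : ∀ R : ℝ, (2 * Complex.I) * ((∫ u in -R..R,
      Real.sin (Real.pi * α) * (c * Real.exp (α * u)) /
        ((c * Real.exp (α * u)) ^ 2 + 2 * (c * Real.exp (α * u)) * Real.cos (Real.pi * α) + 1) *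
        (Real.exp u / (Real.exp u + 1)) : ℝ) : ℂ) =
      Complex.I * (∫ y in -Real.pi..Real.pi, H ((-R : ℝ) + y * Complex.I)) -
      Complex.I * (∫ y in -Real.pi..Real.pi, H (R + y * Complex.I)) := by
    intro R
    have hz := Complex.integral_boundary_rect_eq_zero_of_differentiableOn H
      ((-R : ℝ) + (-Real.pi : ℝ) * Complex.I) (R + Real.pi * Complex.I)
      (hH.mono fun w hw => by
        have := hw.2
        simpa [uIcc_of_le, abs_le, hpi.le] using this)
    have hline : ∀ b : ℝ, |b| ≤ Real.pi → Continuous fun x : ℝ => H (x + b * Complex.I) :=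
      fun b hb => hH.continuousOn.comp_continuous (by fun_prop) fun x => by simpa using hb
    simp only [Complex.add_re, Complex.add_im, Complex.ofReal_re, Complex.ofReal_im,
      Complex.re_ofReal_mul, Complex.im_ofReal_mul, Complex.I_re, Complex.I_im, mul_zero, mul_one,
      add_zero, zero_add, smul_eq_mul] at hz
    rw [← intervalIntegral.integral_sub
      ((hline _ (by simp [abs_of_pos hpi])).intervalIntegrable _ _)
      ((hline _ (by simp [abs_of_pos hpi])).intervalIntegrable _ _)] at hz
    rw [← intervalIntegral.integral_ofReal, ← intervalIntegral.integral_const_mul]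
    rw [intervalIntegral.integral_congr (g := fun x : ℝ =>
      H (x + (-Real.pi : ℝ) * Complex.I) - H (x + Real.pi * Complex.I))]
    · linear_combination hz
    intro x _
    have hne : ∀ b : ℝ, b ≠ 0 → (x : ℂ) + b * Complex.I ≠ 0 := fun b hb h =>
      hb (by simpa using congrArg Complex.im h)
    have hE1 : Complex.exp ((x : ℂ) + (-Real.pi : ℝ) * Complex.I) = -(Real.exp x : ℂ) := by
      rw [Complex.exp_add]; push_cast; rw [neg_mul, Complex.exp_neg, Complex.exp_pi_mul_I]; norm_num
    have hE2 : Complex.exp ((x : ℂ) + Real.pi * Complex.I) = -(Real.exp x : ℂ) := by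
      rw [Complex.exp_add]; push_cast; rw [Complex.exp_pi_mul_I]; norm_num
    have hA : ∀ ε : ℝ, Complex.exp (α * ((x : ℂ) + (ε * Real.pi : ℝ) * Complex.I)) =
        Real.exp (α * x) * (Complex.cos (ε * (Real.pi * α)) +
          Complex.sin (ε * (Real.pi * α)) * Complex.I) := fun ε => by
      rw [← Complex.exp_mul_I, Complex.ofReal_exp, ← Complex.exp_add]
      congr 1; push_cast; ring
    have hA1 := hA (-1)
    have hA2 := hA 1
    have hb1 : |((x : ℂ) + (-Real.pi : ℝ) * Complex.I).im| ≤ Real.pi := by simp [abs_of_pos hpi]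
    have hb2 : |((x : ℂ) + Real.pi * Complex.I).im| ≤ Real.pi := by simp [abs_of_pos hpi]
    have him : ∀ w : ℂ, |w.im| ≤ Real.pi → (c : ℂ) * Complex.exp (α * w) + 1 ≠ 0 := fun w hw => by
      refine Complex.mul_exp_add_one_ne_zero hc ?_
      simp only [Complex.mul_im, Complex.ofReal_re, Complex.ofReal_im, zero_mul, add_zero, abs_mul,
        abs_of_pos hα]
      nlinarith
    have hd1 := him _ hb1
    have hd2 := him _ hb2
    simp only [neg_one_mul, one_mul, Complex.ofReal_neg, Complex.ofReal_one, Complex.cos_neg,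
      Complex.sin_neg] at hA1 hA2
    simp only
    rw [hHeq _ (hne _ (by simp [hpi.ne'])) hb1, hHeq _ (hne _ hpi.ne') hb2, hE1, hE2]
    simp only [Complex.ofReal_neg] at *
    rw [hA1] at hd1 ⊢
    rw [hA2] at hd2 ⊢
    have hsc := Complex.sin_sq_add_cos_sq (Real.pi * α)
    have hx : (Real.exp x : ℂ) + 1 ≠ 0 := by
      exact_mod_cast (by positivity : Real.exp x + 1 ≠ 0)
    push_cast at *
    generalize Complex.exp (α * x) = A at *
    generalize Complex.exp x = E at *
    generalize Complex.sin (Real.pi * α) = S at *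
    generalize Complex.cos (Real.pi * α) = C at *
    have hprod : (c * A) ^ 2 + 2 * (c * A) * C + 1 =
        (c * (A * (C + -S * Complex.I)) + 1) * (c * (A * (C + S * Complex.I)) + 1) := by
      linear_combination (-(c : ℂ) ^ 2 * A ^ 2) * hsc + (c : ℂ) ^ 2 * A ^ 2 * S ^ 2 * Complex.I_sq
    have hx' : -E - 1 ≠ 0 := fun h => hx (by linear_combination -h)
    have hEE : -E / (-E - 1) = E / (E + 1) := by
      field_simp; ring
    rw [hprod, hEE, ← sub_mul, sub_sub_sub_cancel_right, ← mul_assoc, div_sub_div _ _ hd1 hd2,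
      mul_div_assoc']
    ring
  have hlim := (hleft.const_mul Complex.I).sub (hright.const_mul Complex.I)
  rw [← funext hrect] at hlim
  have hlim' := (Complex.continuous_re.tendsto _).comp (hlim.const_mul (-Complex.I / 2))
  refine (hlim'.congr fun R => ?_).trans (le_of_eq ?_)
  · simp only [Function.comp]
    rw [← mul_assoc, show -Complex.I / 2 * (2 * Complex.I) = 1 by
      linear_combination -Complex.I_mul_I, one_mul, Complex.ofReal_re]
  · congr 1
    rw [show -Complex.I / 2 * (Complex.I * ((Real.pi - (-Real.pi : ℝ)) * 0) -
      Complex.I * ((Real.pi - (-Real.pi : ℝ)) * -(1 / (c + 1)))) = ((Real.pi / (c + 1) : ℝ) : ℂ) by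
        push_cast
        linear_combination (-(Real.pi : ℂ) / (c + 1)) * Complex.I_mul_I, Complex.ofReal_re]

open ProbabilityTheory in
theorem measure_ext_of_mgf_eqOn {μ ν : Measure ℝ} [IsFiniteMeasure μ] [IsFiniteMeasure ν]
    (hμ : Ioo (-1) 1 ⊆ integrableExpSet id μ) (hν : Ioo (-1) 1 ⊆ integrableExpSet id ν)
    (h : ∀ x ∈ Ioo (-1 : ℝ) 1, mgf id μ x = mgf id ν x) : μ = ν := by
  have hanalytic : ∀ {ρ : Measure ℝ}, Ioo (-1) 1 ⊆ integrableExpSet id ρ →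
      AnalyticOnNhd ℂ (complexMGF id ρ) {z : ℂ | z.re ∈ Ioo (-1 : ℝ) 1} := fun hρ =>
    analyticOnNhd_complexMGF.mono fun z hz => isOpen_Ioo.subset_interior_iff.2 hρ hz
  have hconn : IsPreconnected {z : ℂ | z.re ∈ Ioo (-1 : ℝ) 1} :=
    ((convex_Ioo (-1 : ℝ) 1).linear_preimage Complex.reLm).isPreconnected
  have hfreq : ∃ᶠ z in 𝓝[≠] (0 : ℂ), complexMGF id μ z = complexMGF id ν z := by
    have hev : ∀ᶠ x : ℝ in 𝓝[≠] (0 : ℝ), complexMGF id μ (x : ℂ) = complexMGF id ν (x : ℂ) := by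
      filter_upwards [nhdsWithin_le_nhds (Ioo_mem_nhds (by norm_num : (-1 : ℝ) < 0) one_pos)]
        with x hx
      rw [complexMGF_ofReal, complexMGF_ofReal, h x hx]
    have ht : Tendsto (fun x : ℝ => (x : ℂ)) (𝓝[≠] 0) (𝓝[≠] 0) := by
      refine tendsto_nhdsWithin_iff.2 ⟨?_, ?_⟩
      · exact (Complex.continuous_ofReal.tendsto' 0 0 rfl).mono_left nhdsWithin_le_nhds
      · filter_upwards [self_mem_nhdsWithin] with x hx
        simpa using hx
    exact ht.frequently hev.frequently
  have heq := (hanalytic hμ).eqOn_of_preconnected_of_frequently_eq (hanalytic hν) hconn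
    (z₀ := 0) (by simp) hfreq
  refine Measure.ext_of_charFun (funext fun t => ?_)
  rw [← complexMGF_id_mul_I, ← complexMGF_id_mul_I]
  exact heq (by simp)

theorem ae_eq_of_laplace_eq {f g : ℝ → ℝ≥0∞} {s₀ : ℝ} (hf : Measurable f) (hg : Measurable g)
    (hfin : ∀ s > s₀, ∫⁻ t in Ioi (0 : ℝ), ENNReal.ofReal (Real.exp (-(s * t))) * f t ≠ ∞)
    (heq : ∀ s > s₀, ∫⁻ t in Ioi (0 : ℝ), ENNReal.ofReal (Real.exp (-(s * t))) * f t =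
      ∫⁻ t in Ioi (0 : ℝ), ENNReal.ofReal (Real.exp (-(s * t))) * g t) :
    f =ᵐ[volume.restrict (Ioi 0)] g := by
  set e : ℝ → ℝ≥0∞ := fun t => ENNReal.ofReal (Real.exp (-((s₀ + 1) * t))) with he
  have hem : Measurable e := by fun_prop
  have key : ∀ {k : ℝ → ℝ≥0∞}, Measurable k → ∀ x : ℝ,
      ∫⁻ t, ENNReal.ofReal (Real.exp (x * t))
        ∂((volume.restrict (Ioi 0)).withDensity fun t => e t * k t) =
      ∫⁻ t in Ioi (0 : ℝ), ENNReal.ofReal (Real.exp (-((s₀ + 1 - x) * t))) * k t := by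
    intro k hk x
    rw [lintegral_withDensity_eq_lintegral_mul _ (by fun_prop) (by fun_prop)]
    refine lintegral_congr fun t => ?_
    simp only [Pi.mul_apply, he]
    rw [mul_right_comm, ← ENNReal.ofReal_mul (Real.exp_nonneg _), ← Real.exp_add]
    ring_nf
  have hgfin : ∀ s > s₀, ∫⁻ t in Ioi (0 : ℝ), ENNReal.ofReal (Real.exp (-(s * t))) * g t ≠ ∞ :=
    fun s hs => heq s hs ▸ hfin s hs
  have hfinite : ∀ {k : ℝ → ℝ≥0∞},
      (∀ s > s₀, ∫⁻ t in Ioi (0 : ℝ), ENNReal.ofReal (Real.exp (-(s * t))) * k t ≠ ∞) →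
      IsFiniteMeasure ((volume.restrict (Ioi 0)).withDensity fun t => e t * k t) :=
    fun hk => isFiniteMeasure_withDensity (hk (s₀ + 1) (by simp))
  have := hfinite hfin
  have := hfinite hgfin
  have hintegral : ∀ {k : ℝ → ℝ≥0∞}, Measurable k →
      (∀ s > s₀, ∫⁻ t in Ioi (0 : ℝ), ENNReal.ofReal (Real.exp (-(s * t))) * k t ≠ ∞) →
      Ioo (-1) 1 ⊆ ProbabilityTheory.integrableExpSet id
        ((volume.restrict (Ioi 0)).withDensity fun t => e t * k t) := by
    intro k hk hkf x hx
    refine (lintegral_ofReal_ne_top_iff_integrable (by fun_prop)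
      (ae_of_all _ fun t => Real.exp_nonneg _)).1 ?_
    simp only [id]
    rw [key hk]
    exact hkf _ (by linarith [hx.2])
  have hmeas := measure_ext_of_mgf_eqOn (hintegral hf hfin) (hintegral hg hgfin) fun x hx => by
    rw [ProbabilityTheory.mgf, ProbabilityTheory.mgf,
      integral_eq_lintegral_of_nonneg_ae (ae_of_all _ fun t => Real.exp_nonneg _) (by fun_prop),
      integral_eq_lintegral_of_nonneg_ae (ae_of_all _ fun t => Real.exp_nonneg _) (by fun_prop)]
    simp only [id]
    rw [key hf, key hg, heq _ (by linarith [hx.2])]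
  have hae := (withDensity_eq_iff (by fun_prop) (by fun_prop) (hfin _ (by simp))).1 hmeas
  filter_upwards [hae] with t ht
  refine (ENNReal.mul_right_inj ?_ ENNReal.ofReal_ne_top).1 ht
  simp [Real.exp_pos]

/-- The density of the measure whose Laplace transform is `t ^ (α - 1) * E_{α,α}(-t ^ α)`. -/
def mlDensity (α r : ℝ) : ℝ :=
  Real.sin (Real.pi * α) / Real.pi * r ^ α / ((r ^ α) ^ 2 + 2 * r ^ α * Real.cos (Real.pi * α) + 1)

theorem sin_pi_mul_pos {α : ℝ} (hα : 0 < α) (hα1 : α < 1) : 0 < Real.sin (Real.pi * α) :=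
  Real.sin_pos_of_pos_of_lt_pi (by positivity) (by nlinarith [Real.pi_pos])

theorem sin_sq_le_quadratic (x θ : ℝ) :
    Real.sin θ ^ 2 ≤ x ^ 2 + 2 * x * Real.cos θ + 1 := by
  nlinarith [Real.sin_sq_add_cos_sq θ, sq_nonneg (x + Real.cos θ)]

theorem quadratic_pos {α : ℝ} (hα : 0 < α) (hα1 : α < 1) (x : ℝ) :
    0 < x ^ 2 + 2 * x * Real.cos (Real.pi * α) + 1 :=
  (pow_pos (sin_pi_mul_pos hα hα1) 2).trans_le (sin_sq_le_quadratic _ _)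

theorem mlDensity_nonneg {α r : ℝ} (hα : 0 < α) (hα1 : α < 1) (hr : 0 ≤ r) :
    0 ≤ mlDensity α r := by
  have := sin_pi_mul_pos hα hα1
  have := quadratic_pos hα hα1 (r ^ α)
  unfold mlDensity
  positivity

theorem measurable_mlDensity (α : ℝ) : Measurable (mlDensity α) := by
  unfold mlDensity
  fun_prop

theorem mlDensity_le {α r : ℝ} (hα : 0 < α) (hα1 : α < 1) (hr : 0 ≤ r) :
    mlDensity α r ≤ Real.sin (Real.pi * α) / Real.pi / Real.sin (Real.pi * α) ^ 2 * r ^ α := by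
  have hs := sin_pi_mul_pos hα hα1
  rw [div_mul_eq_mul_div]
  exact div_le_div_of_nonneg_left (by positivity) (by positivity) (sin_sq_le_quadratic _ _)

theorem lintegral_mlDensity_div {α s : ℝ} (hα : 0 < α) (hα1 : α < 1) (hs : 0 < s) :
    ∫⁻ r in Ioi (0 : ℝ), ENNReal.ofReal (mlDensity α r / (r + s)) =
      ENNReal.ofReal (1 / (s ^ α + 1)) := by
  have hc : 0 < s ^ α := Real.rpow_pos_of_pos hs α
  have hsin := sin_pi_mul_pos hα hα1
  have hlim := tendsto_intervalIntegral_stieltjes hα hα1 hc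
  set g : ℝ → ℝ := fun u => Real.sin (Real.pi * α) * (s ^ α * Real.exp (α * u)) /
    ((s ^ α * Real.exp (α * u)) ^ 2 + 2 * (s ^ α * Real.exp (α * u)) * Real.cos (Real.pi * α) + 1) *
    (Real.exp u / (Real.exp u + 1)) with hg
  have hg0 : ∀ u, 0 ≤ g u := fun u => by
    have := quadratic_pos hα hα1 (s ^ α * Real.exp (α * u))
    simp only [hg]
    positivity
  have hgc : Continuous g := by
    refine Continuous.mul (Continuous.div (by fun_prop) (by fun_prop) fun u =>
      (quadratic_pos hα hα1 _).ne') (Continuous.div (by fun_prop) (by fun_prop) fun u => ?_)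
    positivity
  have hgi : Integrable g := by
    refine integrable_of_intervalIntegral_norm_tendsto (l := atTop) (Real.pi / (s ^ α + 1))
      (fun R : ℝ => (hgc.integrableOn_Icc (a := -R) (b := R)).mono_set Ioc_subset_Icc_self)
      tendsto_neg_atTop_atBot tendsto_id ?_
    simpa [Real.norm_of_nonneg (hg0 _)] using hlim
  have hgint : ∫ u, g u = Real.pi / (s ^ α + 1) :=
    tendsto_nhds_unique
      (intervalIntegral_tendsto_integral hgi tendsto_neg_atTop_atBot tendsto_id) hlim
  have himage : Ioi (0 : ℝ) = (fun u => s * Real.exp u) '' univ := by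
    ext r
    simp only [mem_Ioi, image_univ, mem_range]
    refine ⟨fun hr => ⟨Real.log (r / s), ?_⟩, ?_⟩
    · rw [Real.exp_log (by positivity)]
      field_simp
    · rintro ⟨u, rfl⟩
      positivity
  rw [himage, lintegral_image_eq_lintegral_abs_deriv_mul (f' := fun u => s * Real.exp u)
    MeasurableSet.univ (fun u _ => ((Real.hasDerivAt_exp u).const_mul s).hasDerivWithinAt)
    (fun u _ v _ h => Real.exp_injective (mul_left_cancel₀ hs.ne' h)), Measure.restrict_univ]
  have hcongr : ∀ u : ℝ, ENNReal.ofReal |s * Real.exp u| *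
      ENNReal.ofReal (mlDensity α (s * Real.exp u) / (s * Real.exp u + s)) =
      ENNReal.ofReal (1 / Real.pi * g u) := fun u => by
    rw [← ENNReal.ofReal_mul (abs_nonneg _), abs_of_pos (by positivity), mlDensity,
      Real.mul_rpow hs.le (Real.exp_nonneg u), ← Real.exp_mul, mul_comm u α]
    congr 1
    have := (quadratic_pos hα hα1 (s ^ α * Real.exp (α * u))).ne'
    simp only [hg]
    generalize Real.exp (α * u) = A at *
    rw [show s * Real.exp u + s = s * (Real.exp u + 1) by ring]
    generalize (s ^ α * A) ^ 2 + 2 * (s ^ α * A) * Real.cos (Real.pi * α) + 1 = D at *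
    have hE : Real.exp u + 1 ≠ 0 := by positivity
    generalize Real.exp u = E at *
    field_simp
  rw [lintegral_congr hcongr, ← ofReal_integral_eq_lintegral_ofReal (hgi.const_mul _)
    (ae_of_all _ fun u => mul_nonneg (by positivity) (hg0 u)), integral_const_mul, hgint]
  congr 1
  field_simp

theorem lintegral_exp_neg_mul_rpow {a s : ℝ} (ha : 0 < a) (hs : 0 < s) :
    ∫⁻ t in Ioi (0 : ℝ), ENNReal.ofReal (Real.exp (-(s * t))) *
      ENNReal.ofReal (t ^ (a - 1) / Real.Gamma a) = ENNReal.ofReal (s ^ (-a)) := by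
  have hΓ := Real.Gamma_pos_of_pos ha
  have hintegral : ∫ t in Ioi (0 : ℝ), t ^ (a - 1) * Real.exp (-(s * t)) = (1 / s) ^ a * Real.Gamma a :=
    Real.integral_rpow_mul_exp_neg_mul_Ioi ha hs
  have hi : IntegrableOn (fun t => t ^ (a - 1) * Real.exp (-(s * t))) (Ioi 0) :=
    .of_integral_ne_zero (by rw [hintegral]; positivity)
  have hcongr : ∀ t : ℝ, ENNReal.ofReal (Real.exp (-(s * t))) *
      ENNReal.ofReal (t ^ (a - 1) / Real.Gamma a) =
      ENNReal.ofReal (t ^ (a - 1) * Real.exp (-(s * t)) / Real.Gamma a) := fun t => by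
    rw [← ENNReal.ofReal_mul (Real.exp_nonneg _)]
    congr 1
    ring
  rw [lintegral_congr hcongr, ← ofReal_integral_eq_lintegral_ofReal (hi.div_const _),
    integral_div, hintegral, mul_div_cancel_right₀ _ hΓ.ne', one_div, Real.inv_rpow hs.le,
    Real.rpow_neg hs.le]
  filter_upwards [ae_restrict_mem measurableSet_Ioi] with t ht
  have : 0 < t := ht
  simp only [Pi.zero_apply]
  positivity

/-- The terms, up to sign, of the series of `t ^ (α - 1) * E_{α,α}(-t ^ α)`. -/
def mlTerm (α : ℝ) (k : ℕ) (t : ℝ) : ℝ :=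
  t ^ (α * (k + 1) - 1) / Real.Gamma (α * (k + 1))

theorem measurable_mlTerm (α : ℝ) (k : ℕ) : Measurable (mlTerm α k) := by
  unfold mlTerm
  fun_prop

theorem mlTerm_nonneg {α t : ℝ} (hα : 0 < α) (k : ℕ) (ht : 0 ≤ t) : 0 ≤ mlTerm α k t :=
  div_nonneg (Real.rpow_nonneg ht _) (Real.Gamma_pos_of_pos (by positivity)).le

theorem mlTerm_eq {α t : ℝ} (k : ℕ) (ht : 0 < t) :
    mlTerm α k t = t ^ (α - 1) * ((t ^ α) ^ k / Real.Gamma (α * k + α)) := by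
  rw [mlTerm, ← Real.rpow_natCast, ← Real.rpow_mul ht.le, mul_div_assoc', ← Real.rpow_add ht]
  ring_nf

theorem lintegral_exp_neg_mul_tsum_mlTerm {α s : ℝ} (hα : 0 < α) (hs : 1 < s) (φ : ℕ → ℕ) :
    ∫⁻ t in Ioi (0 : ℝ), ENNReal.ofReal (Real.exp (-(s * t))) *
      ∑' k, ENNReal.ofReal (mlTerm α (φ k) t) =
      ∑' k, ENNReal.ofReal ((s ^ (-α)) ^ (φ k + 1)) := by
  simp_rw [← ENNReal.tsum_mul_left]
  rw [lintegral_tsum fun k => by have := measurable_mlTerm α (φ k); fun_prop]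
  congr with k
  have hs0 : 0 < s := by linarith
  simp only [mlTerm]
  rw [lintegral_exp_neg_mul_rpow (by positivity) hs0, ← Real.rpow_natCast, ← Real.rpow_mul hs0.le]
  push_cast
  ring_nf

theorem lintegral_exp_neg_mul_laplace_mlDensity {α s : ℝ} (hα : 0 < α) (hα1 : α < 1) (hs : 0 < s) :
    ∫⁻ t in Ioi (0 : ℝ), ENNReal.ofReal (Real.exp (-(s * t))) *
      ∫⁻ r in Ioi (0 : ℝ), ENNReal.ofReal (Real.exp (-(r * t)) * mlDensity α r) =
      ENNReal.ofReal (1 / (s ^ α + 1)) := by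
  have hm := measurable_mlDensity α
  rw [← lintegral_mlDensity_div hα hα1 hs]
  simp_rw [← lintegral_const_mul' _ _ ENNReal.ofReal_ne_top]
  rw [lintegral_lintegral_swap (by fun_prop)]
  refine setLIntegral_congr_fun measurableSet_Ioi fun r hr => ?_
  have hr0 : 0 < r := hr
  have hrs : 0 < r + s := by positivity
  have h := lintegral_exp_neg_mul_rpow one_pos hrs
  simp only [sub_self, Real.rpow_zero, Real.Gamma_one, div_one, ENNReal.ofReal_one, mul_one,
    Real.rpow_neg_one] at h
  have hcongr : ∀ t : ℝ, ENNReal.ofReal (Real.exp (-(s * t))) *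
      ENNReal.ofReal (Real.exp (-(r * t)) * mlDensity α r) =
      ENNReal.ofReal (mlDensity α r) * ENNReal.ofReal (Real.exp (-((r + s) * t))) := fun t => by
    rw [← ENNReal.ofReal_mul (Real.exp_nonneg _),
      ← ENNReal.ofReal_mul (mlDensity_nonneg hα hα1 hr0.le), ← mul_assoc, ← Real.exp_add, mul_comm]
    ring_nf
  rw [lintegral_congr hcongr, lintegral_const_mul' _ _ ENNReal.ofReal_ne_top, h,
    ← ENNReal.ofReal_mul (mlDensity_nonneg hα hα1 hr0.le), div_eq_mul_inv]

theorem laplace_mlDensity_add_tsum_ae_eq {α : ℝ} (hα : 0 < α) (hα1 : α < 1) :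
    (fun t => (∫⁻ r in Ioi (0 : ℝ), ENNReal.ofReal (Real.exp (-(r * t)) * mlDensity α r)) +
      ∑' k, ENNReal.ofReal (mlTerm α (2 * k + 1) t)) =ᵐ[volume.restrict (Ioi 0)]
      fun t => ∑' k, ENNReal.ofReal (mlTerm α (2 * k) t) := by
  have hm := measurable_mlDensity α
  have hmt := measurable_mlTerm α
  have hF : Measurable fun t : ℝ =>
      ∫⁻ r in Ioi (0 : ℝ), ENNReal.ofReal (Real.exp (-(r * t)) * mlDensity α r) :=
    Measurable.lintegral_prod_right' (f := fun p : ℝ × ℝ =>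
      ENNReal.ofReal (Real.exp (-(p.2 * p.1)) * mlDensity α p.2)) (by fun_prop)
  have hkey : ∀ s > (1 : ℝ), ∃ y : ℝ, 0 < y ∧ y < 1 ∧
      ∫⁻ t in Ioi (0 : ℝ), ENNReal.ofReal (Real.exp (-(s * t))) *
        ((∫⁻ r in Ioi (0 : ℝ), ENNReal.ofReal (Real.exp (-(r * t)) * mlDensity α r)) +
          ∑' k, ENNReal.ofReal (mlTerm α (2 * k + 1) t)) = ENNReal.ofReal (y / (1 - y ^ 2)) ∧
      ∫⁻ t in Ioi (0 : ℝ), ENNReal.ofReal (Real.exp (-(s * t))) *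
        ∑' k, ENNReal.ofReal (mlTerm α (2 * k) t) = ENNReal.ofReal (y / (1 - y ^ 2)) := by
    intro s hs
    have hs0 : (0 : ℝ) < s := by linarith
    have hy : s ^ α = (s ^ (-α))⁻¹ := by rw [Real.rpow_neg hs0.le, inv_inv]
    have hy0 : 0 < s ^ (-α) := by positivity
    have hy1 : s ^ (-α) < 1 := Real.rpow_lt_one_of_one_lt_of_neg hs (by linarith)
    refine ⟨s ^ (-α), hy0, hy1, ?_, ?_⟩
    · simp_rw [mul_add]
      rw [lintegral_add_left (by fun_prop), lintegral_exp_neg_mul_laplace_mlDensity hα hα1 hs0,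
        lintegral_exp_neg_mul_tsum_mlTerm hα hs, hy]
      generalize s ^ (-α) = y at *
      have hy2 : y ^ 2 < 1 := by nlinarith
      have h2 := (hasSum_geometric_of_lt_one (sq_nonneg y) hy2).mul_left (y ^ 2)
      rw [← ENNReal.ofReal_tsum_of_nonneg (fun k => by positivity)]
      · rw [show (∑' k : ℕ, y ^ (2 * k + 1 + 1)) = y ^ 2 * (1 - y ^ 2)⁻¹ from
          (h2.congr_fun fun k => by ring).tsum_eq]
        have h3 : 0 < 1 - y ^ 2 := by linarith
        rw [← ENNReal.ofReal_add (by positivity) (by positivity)]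
        congr 1
        have h4 : 1 + y ≠ 0 := by positivity
        have h5 : 1 - y ≠ 0 := by linarith
        rw [show 1 - y ^ 2 = (1 + y) * (1 - y) by ring]
        field_simp
        ring
      · exact (h2.congr_fun fun k => by ring).summable
    · rw [lintegral_exp_neg_mul_tsum_mlTerm hα hs]
      generalize s ^ (-α) = y at *
      have hy2 : y ^ 2 < 1 := by nlinarith
      have h2 := (hasSum_geometric_of_lt_one (sq_nonneg y) hy2).mul_left y
      have h3 : HasSum (fun k : ℕ => y ^ (2 * k + 1)) (y * (1 - y ^ 2)⁻¹) := by
        refine h2.congr_fun fun k => by ring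
      rw [← ENNReal.ofReal_tsum_of_nonneg (fun k => by positivity) h3.summable, h3.tsum_eq,
        div_eq_mul_inv]
  refine ae_eq_of_laplace_eq (s₀ := 1) (by fun_prop) (by fun_prop) (fun s hs => ?_) fun s hs => ?_
  · obtain ⟨y, -, -, h, -⟩ := hkey s hs
    rw [h]
    exact ENNReal.ofReal_ne_top
  · obtain ⟨y, -, -, h, h'⟩ := hkey s hs
    rw [h, h']

theorem summable_pow_div_Gamma {α : ℝ} (hα : 0 < α) (x : ℝ) :
    Summable fun k : ℕ => x ^ k / Real.Gamma (α * k + α) := by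
  have hmt := measurable_mlTerm α
  have hlap := lintegral_exp_neg_mul_tsum_mlTerm hα one_lt_two id
  have hy0 : (0 : ℝ) < 2 ^ (-α) := by positivity
  have hy1 : (2 : ℝ) ^ (-α) < 1 := Real.rpow_lt_one_of_one_lt_of_neg one_lt_two (by linarith)
  have hfin : ∫⁻ t in Ioi (0 : ℝ), ENNReal.ofReal (Real.exp (-(2 * t))) *
      ∑' k, ENNReal.ofReal (mlTerm α k t) ≠ ∞ := by
    simp only [id] at hlap
    rw [hlap]
    have : Summable fun k : ℕ => ((2 : ℝ) ^ (-α)) ^ (k + 1) :=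
      (summable_nat_add_iff 1).2 (summable_geometric_of_lt_one hy0.le hy1)
    exact this.tsum_ofReal_ne_top
  have hae := ae_restrict_of_ae_restrict_of_subset
    (Ioi_subset_Ioi (le_max_left 0 (|x| ^ α⁻¹))) (ae_lt_top (by fun_prop) hfin)
  have hpos : (volume.restrict (Ioi (max 0 (|x| ^ α⁻¹)))) ≠ 0 := by simp
  have : (ae (volume.restrict (Ioi (max 0 (|x| ^ α⁻¹))))).NeBot := ae_neBot.2 hpos
  obtain ⟨T, hT, hTmem⟩ := (hae.and (ae_restrict_mem measurableSet_Ioi)).exists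
  have hT0 : 0 < T := (le_max_left _ _).trans_lt hTmem
  have hxT : |x| ≤ T ^ α := by
    have h1 : |x| ^ α⁻¹ ≤ T := (le_max_right _ _).trans hTmem.le
    calc |x| = (|x| ^ α⁻¹) ^ α := by
          rw [← Real.rpow_mul (abs_nonneg x), inv_mul_cancel₀ hα.ne', Real.rpow_one]
      _ ≤ T ^ α := Real.rpow_le_rpow (by positivity) h1 hα.le
  have hsum : Summable fun k : ℕ => mlTerm α k T := by
    have h : ∑' k, ENNReal.ofReal (mlTerm α k T) ≠ ∞ := fun h => by
      simp [h, ENNReal.mul_top, Real.exp_pos] at hT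
    have := ENNReal.summable_toReal h
    simpa [ENNReal.toReal_ofReal (mlTerm_nonneg hα _ hT0.le)] using this
  have hsum' : Summable fun k : ℕ => (T ^ α) ^ k / Real.Gamma (α * k + α) :=
    (summable_mul_left_iff (Real.rpow_pos_of_pos hT0 (α - 1)).ne').1
      (hsum.congr fun k => mlTerm_eq k hT0)
  refine hsum'.of_norm_bounded fun k => ?_
  have hΓ : 0 < Real.Gamma (α * k + α) := Real.Gamma_pos_of_pos (by positivity)
  rw [norm_div, norm_pow, Real.norm_of_nonneg hΓ.le, Real.norm_eq_abs]
  gcongr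

theorem continuous_mlE {α : ℝ} (hα : 0 < α) : Continuous (mlE α α) := by
  refine continuous_iff_continuousAt.2 fun x => ?_
  have hΓ : ∀ k : ℕ, 0 < Real.Gamma (α * k + α) := fun k => Real.Gamma_pos_of_pos (by positivity)
  have h : ContinuousOn (mlE α α) (Metric.ball 0 (|x| + 1)) := by
    refine continuousOn_tsum (fun k => by fun_prop)
      (summable_pow_div_Gamma hα (|x| + 1)) fun k y hy => ?_
    rw [norm_div, norm_pow, Real.norm_of_nonneg (hΓ k).le]
    have := hΓ k
    gcongr
    exact (mem_ball_zero_iff.1 hy).le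
  exact h.continuousAt (Metric.isOpen_ball.mem_nhds (by simp))

theorem integrableOn_rpow_mul_exp_neg {α t : ℝ} (hα : 0 < α) (ht : 0 < t) :
    IntegrableOn (fun r : ℝ => r ^ α * Real.exp (-(t * r))) (Ioi 0) := by
  have h := Real.integral_rpow_mul_exp_neg_mul_Ioi (a := α + 1) (by positivity) ht
  rw [add_sub_cancel_right] at h
  have := Real.Gamma_pos_of_pos (show 0 < α + 1 by positivity)
  exact .of_integral_ne_zero (by rw [h]; positivity)

theorem norm_exp_neg_mul_mlDensity_le {α r t t' : ℝ} (hα : 0 < α) (hα1 : α < 1) (hr : 0 < r)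
    (ht : t' ≤ t) : ‖Real.exp (-(r * t)) * mlDensity α r‖ ≤
      Real.sin (Real.pi * α) / Real.pi / Real.sin (Real.pi * α) ^ 2 *
        (r ^ α * Real.exp (-(t' * r))) := by
  have h0 := mlDensity_nonneg hα hα1 hr.le
  have hle := mlDensity_le hα hα1 hr.le
  have hexp : Real.exp (-(r * t)) ≤ Real.exp (-(t' * r)) := Real.exp_le_exp.2 (by nlinarith)
  rw [Real.norm_of_nonneg (by positivity), ← mul_assoc, mul_comm]
  exact mul_le_mul hle hexp (Real.exp_nonneg _) (h0.trans hle)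

theorem integrableOn_exp_neg_mul_mlDensity {α t : ℝ} (hα : 0 < α) (hα1 : α < 1) (ht : 0 < t) :
    IntegrableOn (fun r : ℝ => Real.exp (-(r * t)) * mlDensity α r) (Ioi 0) := by
  have hm := measurable_mlDensity α
  refine Integrable.mono' ((integrableOn_rpow_mul_exp_neg hα ht).const_mul
    (Real.sin (Real.pi * α) / Real.pi / Real.sin (Real.pi * α) ^ 2)) (by fun_prop) ?_
  filter_upwards [ae_restrict_mem measurableSet_Ioi] with r hr
  exact norm_exp_neg_mul_mlDensity_le hα hα1 hr le_rfl

theorem continuousOn_integral_exp_neg_mul_mlDensity {α : ℝ} (hα : 0 < α) (hα1 : α < 1) :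
    ContinuousOn (fun t => ∫ r in Ioi (0 : ℝ), Real.exp (-(r * t)) * mlDensity α r) (Ioi 0) := by
  have hm := measurable_mlDensity α
  intro t (ht : 0 < t)
  refine ContinuousAt.continuousWithinAt ?_
  refine continuousAt_of_dominated (Eventually.of_forall fun t => by fun_prop) ?_
    ((integrableOn_rpow_mul_exp_neg hα (half_pos ht)).const_mul
      (Real.sin (Real.pi * α) / Real.pi / Real.sin (Real.pi * α) ^ 2))
    (ae_of_all _ fun r => by fun_prop)
  filter_upwards [Ioi_mem_nhds (half_lt_self ht)] with t' ht'
  filter_upwards [ae_restrict_mem measurableSet_Ioi] with r hr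
  exact norm_exp_neg_mul_mlDensity_le hα hα1 hr (le_of_lt ht')

/-- The spectral representation of the kernel `t ^ (α - 1) * E_{α,α}(-t ^ α)`. -/
theorem rpow_mul_mlE_eq_integral {α t : ℝ} (hα : 0 < α) (hα1 : α < 1) (ht : 0 < t) :
    t ^ (α - 1) * mlE α α (-t ^ α) =
      ∫ r in Ioi (0 : ℝ), Real.exp (-(r * t)) * mlDensity α r := by
  have hcont : ContinuousOn (fun t : ℝ => t ^ (α - 1) * mlE α α (-t ^ α)) (Ioi 0) := by
    have hne : ∀ x ∈ Ioi (0 : ℝ), x ≠ 0 := fun x hx => ne_of_gt hx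
    refine ContinuousOn.mul (fun x hx => ?_) ((continuous_mlE hα).comp_continuousOn
      (ContinuousOn.neg fun x hx => ?_))
    · exact (Real.continuousAt_rpow_const x _ (Or.inl (hne x hx))).continuousWithinAt
    · exact (Real.continuousAt_rpow_const x _ (Or.inl (hne x hx))).continuousWithinAt
  refine Measure.eqOn_open_of_ae_eq (μ := volume) ?_ isOpen_Ioi hcont
    (continuousOn_integral_exp_neg_mul_mlDensity hα hα1) ht
  filter_upwards [laplace_mlDensity_add_tsum_ae_eq hα hα1, ae_restrict_mem measurableSet_Ioi]
    with t heq (ht : 0 < t)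
  have hs : Summable fun k => mlTerm α k t :=
    ((summable_pow_div_Gamma hα (t ^ α)).mul_left (t ^ (α - 1))).congr fun k => (mlTerm_eq k ht).symm
  have hs0 : Summable fun k => mlTerm α (2 * k) t :=
    hs.comp_injective fun a b h => by simpa using h
  have hs1 : Summable fun k => mlTerm α (2 * k + 1) t :=
    hs.comp_injective (i := fun k => 2 * k + 1) fun a b h => by simpa using h
  have hnn : ∀ k, 0 ≤ mlTerm α k t := fun k => mlTerm_nonneg hα k ht.le
  have hI : 0 ≤ ∫ r in Ioi (0 : ℝ), Real.exp (-(r * t)) * mlDensity α r :=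
    setIntegral_nonneg measurableSet_Ioi fun r hr =>
      mul_nonneg (Real.exp_nonneg _) (mlDensity_nonneg hα hα1 (le_of_lt hr))
  rw [← ofReal_integral_eq_lintegral_ofReal (integrableOn_exp_neg_mul_mlDensity hα hα1 ht),
    ← ENNReal.ofReal_tsum_of_nonneg (fun k => hnn _) hs0,
    ← ENNReal.ofReal_tsum_of_nonneg (fun k => hnn _) hs1,
    ← ENNReal.ofReal_add hI (tsum_nonneg fun k => hnn _),
    ENNReal.ofReal_eq_ofReal_iff (add_nonneg hI (tsum_nonneg fun k => hnn _))
      (tsum_nonneg fun k => hnn _)] at heq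
  · have hsgn : t ^ (α - 1) * mlE α α (-t ^ α) = ∑' k : ℕ, (-1) ^ k * mlTerm α k t := by
      rw [mlE, ← tsum_mul_left]
      refine tsum_congr fun k => ?_
      rw [mlTerm_eq k ht, neg_pow]
      ring
    rw [hsgn, ← tsum_even_add_odd (by simpa using hs0) (by simpa [pow_succ] using hs1.neg)]
    simp only [pow_succ, pow_mul, pow_zero, mul_neg, mul_one, neg_neg, one_pow, one_mul,
      neg_mul, tsum_neg]
    linarith
  · filter_upwards [ae_restrict_mem measurableSet_Ioi] with r hr
    exact mul_nonneg (Real.exp_nonneg _) (mlDensity_nonneg hα hα1 (le_of_lt hr))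

theorem tendsto_rpow_mul_integral_mlDensity {α : ℝ} (hα : 0 < α) (hα1 : α < 1) :
    Tendsto (fun t : ℝ => t ^ (1 + α) * ∫ r in Ioi (0 : ℝ), Real.exp (-(r * t)) * mlDensity α r)
      atTop (𝓝 (-1 / Real.Gamma (-α))) := by
  have hm := measurable_mlDensity α
  have hsin := sin_pi_mul_pos hα hα1
  have hval : ∫ r in Ioi (0 : ℝ), Real.sin (Real.pi * α) / Real.pi *
      (r ^ α * Real.exp (-(1 * r))) = -1 / Real.Gamma (-α) := by
    have h := Real.integral_rpow_mul_exp_neg_mul_Ioi (a := α + 1) (by positivity) one_pos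
    rw [add_sub_cancel_right] at h
    have hrefl := Real.Gamma_mul_Gamma_one_sub (-α)
    have hne : Real.Gamma (-α) ≠ 0 := fun h0 => by
      rw [h0, zero_mul, mul_neg, Real.sin_neg] at hrefl
      have : Real.pi / -Real.sin (Real.pi * α) ≠ 0 :=
        div_ne_zero Real.pi_ne_zero (neg_ne_zero.2 hsin.ne')
      exact this hrefl.symm
    rw [sub_neg_eq_add, add_comm, mul_neg, Real.sin_neg] at hrefl
    have hrefl' : Real.Gamma (-α) * Real.Gamma (α + 1) * Real.sin (Real.pi * α) = -Real.pi := by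
      rw [hrefl, div_neg, neg_mul, div_mul_cancel₀ _ hsin.ne']
    rw [integral_const_mul, h, div_one, Real.one_rpow, one_mul, eq_div_iff hne, div_mul_eq_mul_div,
      div_mul_eq_mul_div, div_eq_iff Real.pi_ne_zero]
    linarith
  rw [← hval]
  have hscale : ∀ᶠ t : ℝ in atTop, ∫ ρ in Ioi (0 : ℝ),
      Real.exp (-(1 * ρ)) * (t ^ α * mlDensity α (ρ / t)) =
      t ^ (1 + α) * ∫ r in Ioi (0 : ℝ), Real.exp (-(r * t)) * mlDensity α r := by
    filter_upwards [eventually_gt_atTop 0] with t ht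
    have h := integral_comp_mul_left_Ioi
      (fun ρ => Real.exp (-(1 * ρ)) * (t ^ α * mlDensity α (ρ / t))) 0 ht
    rw [mul_zero] at h
    rw [← mul_right_inj' (inv_ne_zero ht.ne'), ← smul_eq_mul, ← h, ← mul_assoc, Real.rpow_add ht,
      Real.rpow_one, inv_mul_cancel_left₀ ht.ne', ← integral_const_mul]
    refine setIntegral_congr_fun measurableSet_Ioi fun r _ => ?_
    rw [mul_div_cancel_left₀ _ ht.ne', one_mul, mul_comm t r]
    ring
  refine Tendsto.congr' hscale ?_
  refine tendsto_integral_filter_of_dominated_convergence _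
    (Eventually.of_forall fun t => by fun_prop) ?_
    ((integrableOn_rpow_mul_exp_neg hα one_pos).const_mul
      (Real.sin (Real.pi * α) / Real.pi / Real.sin (Real.pi * α) ^ 2)) ?_
  · filter_upwards [eventually_gt_atTop 0] with t ht
    filter_upwards [ae_restrict_mem measurableSet_Ioi] with r (hr : 0 < r)
    have h0 := mlDensity_nonneg hα hα1 (div_pos hr ht).le
    have hle := mlDensity_le hα hα1 (div_pos hr ht).le
    have htα : 0 < t ^ α := by positivity
    rw [Real.norm_of_nonneg (by positivity), mul_comm (Real.exp _), ← mul_assoc]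
    refine mul_le_mul_of_nonneg_right ?_ (Real.exp_nonneg _)
    rw [Real.div_rpow hr.le ht.le] at hle
    calc t ^ α * mlDensity α (r / t) ≤ t ^ α * (Real.sin (Real.pi * α) / Real.pi /
          Real.sin (Real.pi * α) ^ 2 * (r ^ α / t ^ α)) := by gcongr
      _ = _ := by field_simp
  · filter_upwards [ae_restrict_mem measurableSet_Ioi] with r (hr : 0 < r)
    have hx : Tendsto (fun t : ℝ => (r / t) ^ α) atTop (𝓝 0) := by
      have h := (tendsto_id.const_div_atTop r).rpow_const (p := α) (Or.inr hα.le)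
      rwa [Real.zero_rpow hα.ne'] at h
    have hden : Tendsto (fun t : ℝ => ((r / t) ^ α) ^ 2 +
        2 * (r / t) ^ α * Real.cos (Real.pi * α) + 1) atTop (𝓝 1) := by
      simpa using (((hx.pow 2).add ((hx.const_mul 2).mul_const (Real.cos (Real.pi * α)))).add_const 1)
    have h := (hden.inv₀ one_ne_zero).const_mul
      (Real.sin (Real.pi * α) / Real.pi * (r ^ α * Real.exp (-(1 * r))))
    rw [inv_one, mul_one] at h
    refine h.congr' ?_
    filter_upwards [eventually_gt_atTop 0] with t ht
    have htα : 0 < t ^ α := by positivity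
    have hD := (quadratic_pos hα hα1 ((r / t) ^ α)).ne'
    unfold mlDensity
    generalize ((r / t) ^ α) ^ 2 + 2 * (r / t) ^ α * Real.cos (Real.pi * α) + 1 = D at *
    rw [Real.div_rpow hr.le ht.le]
    field_simp

theorem tendsto_rpow_mul_mlE {α : ℝ} (hα : 0 < α) (hα1 : α < 1) :
    Tendsto (fun t : ℝ => (t ^ α) ^ 2 * mlE α α (-t ^ α)) atTop (𝓝 (-1 / Real.Gamma (-α))) := by
  refine (tendsto_rpow_mul_integral_mlDensity hα hα1).congr' ?_
  filter_upwards [eventually_gt_atTop 0] with t ht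
  rw [← rpow_mul_mlE_eq_integral hα hα1 ht, ← mul_assoc, ← Real.rpow_add ht, ← Real.rpow_natCast,
    ← Real.rpow_mul ht.le]
  ring_nf

theorem stmt_17
    (α lam : ℝ) (hα : 0 < α) (hα1 : α < 1) (hlam : 0 < lam) :
    Tendsto (fun t : ℝ => t ^ (1 + α) * (t ^ (α - 1) * mlE α α (-(lam * t ^ α)))) atTop
        (nhds (-1 / (lam ^ 2 * Real.Gamma (-α)))) ∧
      (fun t : ℝ => t ^ (α - 1) * mlE α α (-(lam * t ^ α))) =O[atTop]
        fun t : ℝ => t ^ (-(1 + α)) := by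
  have hlim : Tendsto (fun t : ℝ => t ^ (1 + α) * (t ^ (α - 1) * mlE α α (-(lam * t ^ α)))) atTop
      (nhds (-1 / (lam ^ 2 * Real.Gamma (-α)))) := by
    have h := ((tendsto_rpow_mul_mlE hα hα1).comp
      (tendsto_id.const_mul_atTop (Real.rpow_pos_of_pos hlam α⁻¹))).const_mul (lam ^ 2)⁻¹
    rw [show (lam ^ 2)⁻¹ * (-1 / Real.Gamma (-α)) = -1 / (lam ^ 2 * Real.Gamma (-α)) by
      rw [div_mul_eq_div_div, div_right_comm, mul_comm, div_eq_mul_inv _ (lam ^ 2)]] at h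
    refine h.congr' ?_
    filter_upwards [eventually_gt_atTop 0] with t ht
    have hscale : (lam ^ α⁻¹ * t) ^ α = lam * t ^ α := by
      rw [Real.mul_rpow (by positivity) ht.le, ← Real.rpow_mul hlam.le, inv_mul_cancel₀ hα.ne',
        Real.rpow_one]
    have hpow : t ^ (1 + α) * t ^ (α - 1) = (t ^ α) ^ 2 := by
      rw [← Real.rpow_add ht, ← Real.rpow_natCast, ← Real.rpow_mul ht.le]
      ring_nf
    simp only [Function.comp, id]
    rw [hscale, ← mul_assoc, ← mul_assoc, hpow, mul_pow, inv_mul_cancel_left₀ (by positivity)]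
  refine ⟨hlim, ?_⟩
  have h := (Asymptotics.isBigO_refl (fun t : ℝ => t ^ (-(1 + α))) atTop).mul (hlim.isBigO_one ℝ)
  refine h.congr' ?_ (by simp)
  filter_upwards [eventually_gt_atTop 0] with t ht
  rw [← mul_assoc, ← Real.rpow_add ht, neg_add_cancel, Real.rpow_zero, one_mul]
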